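/- arXiv:math/0007005 — 3 statements merged into one kernel-verified Lean document; each statement's English description precedes it below -/
import Mathlib

section
/- Let n ≥ 1, let (w; t_1,…,t_d) be an orthocell datum in S_n with t_k = (a_k b_k), a_k < b_k. Then (w; t_1,…,t_d) is monogressive, i.e. ℓ(s_L w) = ℓ(w) + |L| for every L ⊆ {1,…,d}, if and only if for every k ∈ {1,…,d}: (i) w⁻¹(a_k) < w⁻¹(b_k); (ii) every c ∈ {1,…,n} with w⁻¹(a_k) < w⁻¹(c) < w⁻¹(b_k) satisfies c < a_k or c > b_k; and (iii) for every k' ≠ k, if w⁻¹(a_k) < w⁻¹(a_{k'}) < w⁻¹(b_k) or w⁻¹(a_k) < w⁻¹(b_{k'}) < w⁻¹(b_k), then both a_{k'} and b_{k'} lie outside the numerical interval [a_k, b_k] (i.e. each of them is < a_k or > b_k). -/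
open Equiv Finset
open scoped TensorProduct

noncomputable section

namespace QFlag
/-- The number of inversions of a permutation of `Fin n`
(the length `ℓ(w)` of `w` in the Coxeter group `Sₙ`). -/
def invCount {n : ℕ} (w : Equiv.Perm (Fin n)) : ℕ :=
  (Finset.univ.filter fun p : Fin n × Fin n => p.1 < p.2 ∧ w p.2 < w p.1).card

/-- The product `s_L = ∏_{k ∈ L} (a_k b_k)` of the transpositions of the datum
selected by `L ⊆ {1, …, d}` (the factors pairwise commute for an orthocell datum). -/
def sL {n d : ℕ} (t : Fin d → Fin n × Fin n) (L : Finset (Fin d)) : Equiv.Perm (Fin n) :=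
  ((L.sort (· ≤ ·)).map fun k => Equiv.swap (t k).1 (t k).2).prod

/-- `t` lists the transpositions `(a_k b_k)` of an orthocell datum: `a_k < b_k` and the
two-element sets `{a_k, b_k}` are pairwise disjoint. -/
def IsOrthocell {n d : ℕ} (t : Fin d → Fin n × Fin n) : Prop :=
  (∀ k, (t k).1 < (t k).2) ∧
  ∀ k k', k ≠ k' →
    ({(t k).1, (t k).2} : Set (Fin n)) ∩ {(t k').1, (t k').2} = ∅

/-- The orthocell datum `(w; t_1, …, t_d)` is monogressive:
`ℓ(s_L w) = ℓ(w) + |L|` for every `L ⊆ {1, …, d}`. -/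
def Monogressive {n d : ℕ} (w : Equiv.Perm (Fin n)) (t : Fin d → Fin n × Fin n) : Prop :=
  ∀ L : Finset (Fin d), invCount (sL t L * w) = invCount w + L.card

/-- The set `w({1, …, i})` (where `{1, …, i}` means the first `i` elements of `Fin n`). -/
def firstSet {n : ℕ} (w : Equiv.Perm (Fin n)) (i : ℕ) : Finset (Fin n) :=
  (Finset.univ.filter fun p : Fin n => (p : ℕ) < i).image w

/-- The orthocell datum `(w; t_1, …, t_d)` is `i`-effective: for every `k` exactly one of
`a_k`, `b_k` belongs to `w({1, …, i})`. -/
def Effective {n d : ℕ} (w : Equiv.Perm (Fin n)) (t : Fin d → Fin n × Fin n) (i : ℕ) : Prop :=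
  ∀ k, Xor' ((t k).1 ∈ firstSet w i) ((t k).2 ∈ firstSet w i)

theorem inv_mul_swap {n : ℕ} (u : Equiv.Perm (Fin n)) (i j : Fin n) (hij : i < j)
    (hu : u i < u j) :
    invCount (u * Equiv.swap i j) = invCount u +
      (Finset.univ.filter fun p : Fin n × Fin n => p.1 < p.2 ∧
        Equiv.swap i j p.2 < Equiv.swap i j p.1 ∧
        u (Equiv.swap i j p.2) < u (Equiv.swap i j p.1) ∧ u p.1 < u p.2).card := by
  unfold invCount
  set τ := Equiv.swap i j with hτ
  have hττ : ∀ x, τ (τ x) = x := fun x => by simp [hτ]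
  have e1 : (Finset.univ.filter fun p : Fin n × Fin n => p.1 < p.2 ∧ (u * τ) p.2 < (u * τ) p.1).card
      = (Finset.univ.filter fun p : Fin n × Fin n => p.1 < p.2 ∧ τ p.1 < τ p.2 ∧
          u (τ p.2) < u (τ p.1)).card +
        (Finset.univ.filter fun p : Fin n × Fin n => p.1 < p.2 ∧ τ p.2 < τ p.1 ∧
          u (τ p.2) < u (τ p.1)).card := by
    rw [← Finset.card_union_of_disjoint]
    · congr 1
      ext ⟨p, q⟩
      have : p < q → τ p < τ q ∨ τ q < τ p := fun h =>
        lt_or_gt_of_ne (fun h' => h.ne (τ.injective h'))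
      simp only [Finset.mem_filter, Finset.mem_univ, true_and, Finset.mem_union]
      simp only [Equiv.Perm.mul_apply]
      tauto
    · rw [Finset.disjoint_left]
      rintro ⟨p, q⟩ h1 h2
      simp only [Finset.mem_filter, Finset.mem_univ, true_and] at h1 h2
      exact lt_asymm h1.2.1 h2.2.1
  have e2 : (Finset.univ.filter fun p : Fin n × Fin n => p.1 < p.2 ∧ u p.2 < u p.1).card
      = (Finset.univ.filter fun p : Fin n × Fin n => p.1 < p.2 ∧ τ p.1 < τ p.2 ∧
          u p.2 < u p.1).card +
        (Finset.univ.filter fun p : Fin n × Fin n => p.1 < p.2 ∧ τ p.2 < τ p.1 ∧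
          u p.2 < u p.1).card := by
    rw [← Finset.card_union_of_disjoint]
    · congr 1
      ext ⟨p, q⟩
      have : p < q → τ p < τ q ∨ τ q < τ p := fun h =>
        lt_or_gt_of_ne (fun h' => h.ne (τ.injective h'))
      simp only [Finset.mem_filter, Finset.mem_univ, true_and, Finset.mem_union]
      tauto
    · rw [Finset.disjoint_left]
      rintro ⟨p, q⟩ h1 h2
      simp only [Finset.mem_filter, Finset.mem_univ, true_and] at h1 h2
      exact lt_asymm h1.2.1 h2.2.1
  have e3 : (Finset.univ.filter fun p : Fin n × Fin n => p.1 < p.2 ∧ τ p.1 < τ p.2 ∧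
          u (τ p.2) < u (τ p.1)).card =
      (Finset.univ.filter fun p : Fin n × Fin n => p.1 < p.2 ∧ τ p.1 < τ p.2 ∧
          u p.2 < u p.1).card := by
    refine Finset.card_bij' (fun p _ => (τ p.1, τ p.2)) (fun p _ => (τ p.1, τ p.2)) ?_ ?_ ?_ ?_ <;>
    · rintro ⟨p, q⟩ h
      simp only [Finset.mem_filter, Finset.mem_univ, true_and, hττ] at h ⊢
      try tauto
  have e4 : (Finset.univ.filter fun p : Fin n × Fin n => p.1 < p.2 ∧ τ p.2 < τ p.1 ∧
          u (τ p.2) < u (τ p.1)).card =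
      (Finset.univ.filter fun p : Fin n × Fin n => p.1 < p.2 ∧ τ p.2 < τ p.1 ∧
          u p.2 < u p.1).card +
      (Finset.univ.filter fun p : Fin n × Fin n => p.1 < p.2 ∧
        τ p.2 < τ p.1 ∧ u (τ p.2) < u (τ p.1) ∧ u p.1 < u p.2).card := by
    rw [← Finset.card_union_of_disjoint]
    · congr 1
      ext ⟨p, q⟩
      simp only [Finset.mem_filter, Finset.mem_univ, true_and, Finset.mem_union]
      have h1 : p < q → u p < u q ∨ u q < u p := fun h =>
        lt_or_gt_of_ne (fun h' => h.ne (u.injective h'))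
      have h2 : p < q → τ q < τ p → u q < u p → u (τ q) < u (τ p) := by
        intro hpq ht huq
        simp only [hτ, Equiv.swap_apply_def] at ht ⊢
        split_ifs at ht ⊢ <;> subst_vars <;> order
      tauto
    · rw [Finset.disjoint_left]
      rintro ⟨p, q⟩ h1 h2
      simp only [Finset.mem_filter, Finset.mem_univ, true_and] at h1 h2
      exact lt_asymm h1.2.2 h2.2.2.2
  omega

theorem inv_lt {n : ℕ} (u : Equiv.Perm (Fin n)) (i j : Fin n) (hij : i < j)
    (hu : u i < u j) : invCount u < invCount (u * Equiv.swap i j) := by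
  rw [inv_mul_swap u i j hij hu]
  have : 0 < (Finset.univ.filter fun p : Fin n × Fin n => p.1 < p.2 ∧
        Equiv.swap i j p.2 < Equiv.swap i j p.1 ∧
        u (Equiv.swap i j p.2) < u (Equiv.swap i j p.1) ∧ u p.1 < u p.2).card := by
    rw [Finset.card_pos]
    exact ⟨(i, j), by simp [hij, hu]⟩
  omega

theorem inv_succ_iff {n : ℕ} (u : Equiv.Perm (Fin n)) (i j : Fin n) (hij : i < j)
    (hu : u i < u j) : invCount (u * Equiv.swap i j) = invCount u + 1 ↔
      ∀ m, i < m → m < j → u m < u i ∨ u j < u m := by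
  rw [inv_mul_swap u i j hij hu, Nat.add_left_cancel_iff, Finset.card_eq_one]
  constructor
  · rintro ⟨x, hx⟩ m him hmj
    by_contra! hc
    have h0 : (i, j) ∈ ({x} : Finset (Fin n × Fin n)) := by
      rw [← hx]; simp [hij, hu]
    have h1 : (i, m) ∈ ({x} : Finset (Fin n × Fin n)) := by
      have a1 : u i ≠ u m := fun h => him.ne (u.injective h)
      have a2 : u m ≠ u j := fun h => hmj.ne (u.injective h)
      rw [← hx]
      simp only [Finset.mem_filter, Finset.mem_univ, true_and, Equiv.swap_apply_left,
        Equiv.swap_apply_of_ne_of_ne him.ne' hmj.ne]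
      refine ⟨him, hmj, lt_of_le_of_ne hc.2 a2, lt_of_le_of_ne hc.1 a1⟩
    rw [Finset.mem_singleton] at h0 h1
    rw [← h0] at h1
    exact hmj.ne (Prod.ext_iff.1 h1).2
  · intro h
    refine ⟨(i, j), ?_⟩
    ext ⟨p, q⟩
    simp only [Finset.mem_filter, Finset.mem_univ, true_and, Finset.mem_singleton, Prod.mk.injEq]
    constructor
    · rintro ⟨hpq, h1, h2, h3⟩
      have hp := h p
      have hq := h q
      by_cases c1 : p = i <;> by_cases c2 : q = j
      · exact ⟨c1, c2⟩
      all_goals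
        exfalso
        simp only [Equiv.swap_apply_def] at h1 h2
        split_ifs at h1 h2 <;> subst_vars <;>
          first
          | order
          | grind
    · rintro ⟨rfl, rfl⟩
      simp [hij, hu]

theorem crit {n : ℕ} (u : Equiv.Perm (Fin n)) (a b i j : Fin n) (hab : a < b)
    (hi : u i = a) (hj : u j = b) :
    invCount (Equiv.swap a b * u) = invCount u + 1 ↔
      i < j ∧ ∀ m, i < m → m < j → u m < a ∨ b < u m := by
  subst hi hj
  have e : Equiv.swap (u i) (u j) * u = u * Equiv.swap i j := by
    rw [Equiv.mul_swap_eq_swap_mul]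
  rw [e]
  rcases lt_trichotomy i j with h | h | h
  · rw [inv_succ_iff u i j h hab]; simp [h]
  · subst h; exact absurd hab (lt_irrefl _)
  · have := inv_lt (u * Equiv.swap i j) j i h (by simpa using hab)
    rw [Equiv.swap_comm j i, mul_assoc, Equiv.swap_mul_self, mul_one] at this
    constructor
    · intro h'; omega
    · intro h'; exact absurd h'.1 (lt_asymm h)

theorem ortho_ne {n d : ℕ} {t : Fin d → Fin n × Fin n} (ht : IsOrthocell t) {k k' : Fin d}
    (h : k ≠ k') : (t k).1 ≠ (t k').1 ∧ (t k).1 ≠ (t k').2 ∧ (t k).2 ≠ (t k').1 ∧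
      (t k).2 ≠ (t k').2 := by
  have := ht.2 k k' h
  rw [Set.eq_empty_iff_forall_notMem] at this
  have h1 := this (t k).1
  have h2 := this (t k).2
  simp at h1 h2
  tauto

theorem sL_insert {n d : ℕ} {t : Fin d → Fin n × Fin n} (ht : IsOrthocell t)
    (L : Finset (Fin d)) (k : Fin d) (hk : k ∉ L) :
    sL t (insert k L) = Equiv.swap (t k).1 (t k).2 * sL t L := by
  unfold sL
  rw [← List.prod_cons]
  rw [← List.map_cons (f := fun k => Equiv.swap (t k).1 (t k).2)]
  apply List.Perm.prod_eq'
  · apply List.Perm.map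
    rw [← Multiset.coe_eq_coe, ← Multiset.cons_coe, Finset.sort_eq, Finset.sort_eq,
      Finset.insert_val_of_notMem hk]
  · rw [List.pairwise_map]
    apply List.pairwise_of_forall
    intro x y
    by_cases hxy : x = y
    · subst hxy; exact Commute.refl _
    · obtain ⟨h1, h2, h3, h4⟩ := ortho_ne ht hxy
      apply Equiv.Perm.Disjoint.commute
      intro z
      by_cases hz : z = (t x).1 ∨ z = (t x).2
      · right
        rcases hz with rfl | rfl
        · exact Equiv.swap_apply_of_ne_of_ne h1 h2
        · exact Equiv.swap_apply_of_ne_of_ne h3 h4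
      · left
        push Not at hz
        exact Equiv.swap_apply_of_ne_of_ne hz.1 hz.2

theorem sL_apply {n d : ℕ} {t : Fin d → Fin n × Fin n} (ht : IsOrthocell t)
    (L : Finset (Fin d)) : ∀ x, sL t L x = x ∨ ∃ k ∈ L,
      (x = (t k).1 ∧ sL t L x = (t k).2) ∨ (x = (t k).2 ∧ sL t L x = (t k).1) := by
  induction L using Finset.induction_on with
  | empty => intro x; left; simp [sL]
  | insert k L hk ih =>
    intro x
    rw [sL_insert ht L k hk, Equiv.Perm.mul_apply]
    rcases ih x with h | ⟨k', hk', h⟩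
    · rw [h]
      by_cases h1 : x = (t k).1
      · right; exact ⟨k, by simp, Or.inl ⟨h1, by rw [h1]; simp⟩⟩
      by_cases h2 : x = (t k).2
      · right; exact ⟨k, by simp, Or.inr ⟨h2, by rw [h2]; simp⟩⟩
      left; exact Equiv.swap_apply_of_ne_of_ne h1 h2
    · have hne : k' ≠ k := fun h => hk (h ▸ hk')
      obtain ⟨h1, h2, h3, h4⟩ := ortho_ne ht hne
      right
      refine ⟨k', by simp [hk'], ?_⟩
      rcases h with ⟨e, h⟩ | ⟨e, h⟩
      · left; exact ⟨e, by rw [h]; exact Equiv.swap_apply_of_ne_of_ne h3 h4⟩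
      · right; exact ⟨e, by rw [h]; exact Equiv.swap_apply_of_ne_of_ne h1 h2⟩

theorem sL_fix {n d : ℕ} {t : Fin d → Fin n × Fin n} (ht : IsOrthocell t)
    (L : Finset (Fin d)) (k : Fin d) (hk : k ∉ L) :
    sL t L (t k).1 = (t k).1 ∧ sL t L (t k).2 = (t k).2 := by
  constructor
  · rcases sL_apply ht L (t k).1 with h | ⟨k', hk', h⟩
    · exact h
    · have hne : k' ≠ k := fun h => hk (h ▸ hk')
      obtain ⟨h1, h2, h3, h4⟩ := ortho_ne ht hne
      rcases h with ⟨e, -⟩ | ⟨e, -⟩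
      · exact absurd e.symm h1
      · exact absurd e.symm h3
  · rcases sL_apply ht L (t k).2 with h | ⟨k', hk', h⟩
    · exact h
    · have hne : k' ≠ k := fun h => hk (h ▸ hk')
      obtain ⟨h1, h2, h3, h4⟩ := ortho_ne ht hne
      rcases h with ⟨e, -⟩ | ⟨e, -⟩
      · exact absurd e.symm h2
      · exact absurd e.symm h4

theorem sL_crit {n d : ℕ} (w : Equiv.Perm (Fin n)) {t : Fin d → Fin n × Fin n}
    (ht : IsOrthocell t) (L : Finset (Fin d)) (k : Fin d) (hk : k ∉ L) :
    invCount (sL t (insert k L) * w) = invCount (sL t L * w) + 1 ↔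
      w.symm (t k).1 < w.symm (t k).2 ∧ ∀ c, w.symm (t k).1 < w.symm c →
        w.symm c < w.symm (t k).2 → sL t L c < (t k).1 ∨ (t k).2 < sL t L c := by
  obtain ⟨f1, f2⟩ := sL_fix ht L k hk
  rw [sL_insert ht L k hk, mul_assoc, crit (sL t L * w) (t k).1 (t k).2 (w.symm (t k).1)
    (w.symm (t k).2) (ht.1 k) (by simp [f1]) (by simp [f2])]
  refine and_congr_right fun _ => ⟨fun h c h1 h2 => by simpa using h _ h1 h2, fun h m h1 h2 => ?_⟩
  simpa using h (w m) (by simpa using h1) (by simpa using h2)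

/-- Criterion for monogressivity of an orthocell datum
`(w; t_1, …, t_d)` in `Sₙ`, `t k = (a_k, b_k)` with `a_k < b_k`. -/
theorem monogressive_iff {n d : ℕ} (hn : 1 ≤ n)
    (w : Equiv.Perm (Fin n)) (t : Fin d → Fin n × Fin n) (ht : IsOrthocell t) :
    Monogressive w t ↔
      ∀ k : Fin d,
        (w.symm (t k).1 < w.symm (t k).2) ∧
        (∀ c : Fin n, w.symm (t k).1 < w.symm c → w.symm c < w.symm (t k).2 →
          c < (t k).1 ∨ (t k).2 < c) ∧
        (∀ k' : Fin d, k' ≠ k →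
          ((w.symm (t k).1 < w.symm (t k').1 ∧ w.symm (t k').1 < w.symm (t k).2) ∨
            (w.symm (t k).1 < w.symm (t k').2 ∧ w.symm (t k').2 < w.symm (t k).2)) →
          (((t k').1 < (t k).1 ∨ (t k).2 < (t k').1) ∧
            ((t k').2 < (t k).1 ∨ (t k).2 < (t k').2))) := by
  constructor
  · intro hm k
    have h1 : ∀ (L : Finset (Fin d)) (k : Fin d), k ∉ L → _ := fun L k hk =>
      (sL_crit w ht L k hk).1 (by rw [hm, hm, Finset.card_insert_of_notMem hk]; rfl)
    have h0 := h1 ∅ k (by simp)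
    have hs : sL t ∅ = 1 := by simp [sL]
    rw [hs] at h0
    simp only [Equiv.Perm.one_apply] at h0
    refine ⟨h0.1, h0.2, fun k' hk' hb => ?_⟩
    have h2 := (h1 {k'} k (by simpa using hk'.symm)).2
    have hs' : sL t {k'} = Equiv.swap (t k').1 (t k').2 := by simp [sL]
    rw [hs'] at h2
    rcases hb with ⟨b1, b2⟩ | ⟨b1, b2⟩
    · exact ⟨h0.2 _ b1 b2, by simpa using h2 _ b1 b2⟩
    · exact ⟨by simpa using h2 _ b1 b2, h0.2 _ b1 b2⟩
  · intro h L
    induction L using Finset.induction_on with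
    | empty => simp [sL]
    | insert k L hk ih =>
      rw [Finset.card_insert_of_notMem hk, ← add_assoc, ← ih, sL_crit w ht L k hk]
      obtain ⟨h1, h2, h3⟩ := h k
      refine ⟨h1, fun c c1 c2 => ?_⟩
      rcases sL_apply ht L c with e | ⟨k', hk', ⟨e, e'⟩ | ⟨e, e'⟩⟩
      · rw [e]; exact h2 c c1 c2
      · have hne : k' ≠ k := fun h => hk (h ▸ hk')
        rw [e']; subst e
        exact (h3 k' hne (Or.inl ⟨c1, c2⟩)).2
      · have hne : k' ≠ k := fun h => hk (h ▸ hk')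
        rw [e']; subst e
        exact (h3 k' hne (Or.inr ⟨c1, c2⟩)).1

end QFlag
end
end

section
/- For all integers n ≥ 0 and all integers i, j, the identity D(n+1;i,j) = D(n;i−1,j−1) + D(n;i−1,j) + D(n;i,j−1) + D(n;i,j) holds. -/
open Equiv Finset
open scoped TensorProduct

noncomputable section

namespace QFlag

/-- The binomial coefficient `C(n, k)` for an integer `k`, vanishing for `k < 0`
(and for `k > n`). -/
def Cz (n : ℕ) (k : ℤ) : ℤ := if k < 0 then 0 else n.choose k.toNat

/-- `D(n; i, j) = C(n,i)·C(n,j) − C(n,i−1)·C(n,j+1)`. -/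
def Dz (n : ℕ) (i j : ℤ) : ℤ := Cz n i * Cz n j - Cz n (i - 1) * Cz n (j + 1)

/-- The Pascal rule for all integers `k`. -/
theorem Cz_succ (n : ℕ) (k : ℤ) : Cz (n + 1) k = Cz n k + Cz n (k - 1) := by
  unfold Cz
  rcases lt_trichotomy k 0 with h | h | h
  · rw [if_pos h, if_pos h, if_pos (by omega)]; rfl
  · subst h; simp
  · obtain ⟨m, rfl⟩ : ∃ m : ℕ, k = (m : ℤ) + 1 := ⟨(k - 1).toNat, by omega⟩
    have h1 : ((m : ℤ) + 1).toNat = m + 1 := by omega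
    have h2 : ((m : ℤ) + 1 - 1).toNat = m := by omega
    rw [if_neg (by omega), if_neg (by omega), if_neg (by omega), h1, h2, Nat.choose_succ_succ]
    push_cast
    ring

/-- The recursion
`D(n+1; i, j) = D(n; i−1, j−1) + D(n; i−1, j) + D(n; i, j−1) + D(n; i, j)`. -/
theorem D_recursion (n : ℕ) (i j : ℤ) :
    Dz (n + 1) i j = Dz n (i - 1) (j - 1) + Dz n (i - 1) j + Dz n i (j - 1) + Dz n i j := by
  unfold Dz
  simp only [Cz_succ, sub_add_cancel, add_sub_cancel_right]
  ring

end QFlag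
end
end

section
/- Let n ≥ 2 and 1 ≤ i < j ≤ n−1. The number of ij-normal orthocell data (w; t_1,…,t_d) in S_n, where d ranges over all nonnegative integers and the transpositions form an unordered set listed so that b_1 < ⋯ < b_d, equals D(n;i,j) = C(n,i)·C(n,j) − C(n,i−1)·C(n,j+1). -/
open Equiv Finset
open scoped TensorProduct

noncomputable section

namespace QFlag
/-- The orthocell datum `(w; t_1, …, t_d)` (with `t k = (a_k, b_k)`, `a_k < b_k`) is
`ij`-normal: it is an orthocell datum, monogressive, `ij`-effective, `b_1 < ⋯ < b_d`,
`w(i−d+k) = a_k` and `w(j+k) = b_{d+1−k}` for `1 ≤ k ≤ d` (in particular `d ≤ i` and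
`j + d ≤ n`), and `w(1) > ⋯ > w(i−d)`, `w(i+1) > ⋯ > w(j)`, `w(j+d+1) > ⋯ > w(n)`
(all positions written `1`-based, i.e. position `p` is the element `p-1` of `Fin n`). -/
def IJNormal {n d : ℕ} (i j : ℕ) (w : Equiv.Perm (Fin n)) (t : Fin d → Fin n × Fin n) :
    Prop :=
  IsOrthocell t ∧ Monogressive w t ∧ Effective w t i ∧ Effective w t j ∧
  (∀ k k' : Fin d, k < k' → (t k).2 < (t k').2) ∧
  d ≤ i ∧ j + d ≤ n ∧
  (∀ k : Fin d, (w.symm (t k).1 : ℕ) = i - d + k) ∧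
  (∀ k : Fin d, (w.symm (t k).2 : ℕ) = j + (d - 1 - (k : ℕ))) ∧
  (∀ p q : Fin n, p < q → (q : ℕ) < i - d → w q < w p) ∧
  (∀ p q : Fin n, i ≤ (p : ℕ) → p < q → (q : ℕ) < j → w q < w p) ∧
  (∀ p q : Fin n, j + d ≤ (p : ℕ) → p < q → w q < w p)

def Ch (n : ℕ) (k : ℤ) : ℤ := if k < 0 then 0 else (n.choose k.toNat : ℤ)

lemma Ch_succ (n : ℕ) (k : ℤ) : Ch (n+1) k = Ch n k + Ch n (k-1) := by
  unfold Ch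
  rcases lt_trichotomy k 0 with h | h | h
  · rw [if_pos h, if_pos h, if_pos (by omega)]; simp
  · subst h; simp
  · obtain ⟨m, rfl⟩ : ∃ m : ℕ, k = m + 1 := ⟨(k-1).toNat, by omega⟩
    rw [if_neg (by omega), if_neg (by omega), if_neg (by omega)]
    have h1 : ((m:ℤ)+1).toNat = m+1 := by omega
    have h2 : ((m:ℤ)+1-1).toNat = m := by omega
    rw [h1, h2, Nat.choose_succ_succ]; push_cast; ring

def suf {n : ℕ} (f : Fin n → Bool) (m : ℕ) : ℤ :=
  ∑ x : Fin n, if m ≤ (x : ℕ) ∧ f x = true then 1 else 0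

lemma suf_cons_zero {n : ℕ} (f : Fin (n+1) → Bool) :
    suf f 0 = (if f 0 = true then 1 else 0) + suf (fun x => f x.succ) 0 := by
  unfold suf
  rw [Fin.sum_univ_succ]; simp

lemma suf_cons_succ {n : ℕ} (f : Fin (n+1) → Bool) (m : ℕ) :
    suf f (m+1) = suf (fun x => f x.succ) m := by
  unfold suf
  rw [Fin.sum_univ_succ]; simp

def Good (n : ℕ) (i j : ℤ) (f : (Fin n → Bool) × (Fin n → Bool)) : Prop :=
  suf f.1 0 = i ∧ suf f.2 0 = j ∧ ∀ m, suf f.1 m ≤ suf f.2 m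

def cnt (n : ℕ) (i j : ℤ) : ℤ := Nat.card {f // Good n i j f}

lemma good_succ (n : ℕ) (i j : ℤ) (hij : i ≤ j) (f) :
    Good (n+1) i j f ↔ Good n (i - if f.1 0 = true then 1 else 0)
      (j - if f.2 0 = true then 1 else 0) (fun x => f.1 x.succ, fun x => f.2 x.succ) := by
  unfold Good
  simp only [suf_cons_zero]
  constructor
  · rintro ⟨h1, h2, h3⟩
    refine ⟨by linarith, by linarith, fun m => ?_⟩
    have := h3 (m+1)
    rwa [suf_cons_succ, suf_cons_succ] at this
  · rintro ⟨h1, h2, h3⟩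
    refine ⟨by linarith, by linarith, fun m => ?_⟩
    cases m with
    | zero => rw [suf_cons_zero, suf_cons_zero]; linarith
    | succ m => rw [suf_cons_succ, suf_cons_succ]; exact h3 m

lemma cnt_succ (n : ℕ) (i j : ℤ) (hij : i ≤ j) :
    cnt (n+1) i j = cnt n i j + cnt n (i-1) j + cnt n i (j-1) + cnt n (i-1) (j-1) := by
  have e : {f // Good (n+1) i j f} ≃ (Σ c : Bool × Bool, {f // Good n
      (i - if c.1 = true then 1 else 0) (j - if c.2 = true then 1 else 0) f}) :=
    { toFun := fun f => ⟨(f.1.1 0, f.1.2 0),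
        ⟨(fun x => f.1.1 x.succ, fun x => f.1.2 x.succ), (good_succ n i j hij _).1 f.2⟩⟩
      invFun := fun g => ⟨(Fin.cons g.1.1 g.2.1.1, Fin.cons g.1.2 g.2.1.2),
        (good_succ n i j hij _).2 (by simpa using g.2.2)⟩
      left_inv := by
        rintro ⟨⟨f, g⟩, h⟩
        simp only [Subtype.mk.injEq, Prod.mk.injEq]
        exact ⟨Fin.cons_self_tail f, Fin.cons_self_tail g⟩
      right_inv := by
        rintro ⟨⟨c, c'⟩, ⟨⟨f, g⟩, h⟩⟩
        rfl }
  unfold cnt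
  rw [Nat.card_congr e, Nat.card_sigma, Fintype.sum_prod_type]
  simp
  ring

lemma cnt_eq (n : ℕ) : ∀ i j : ℤ, i ≤ j + 1 →
    cnt n i j = Ch n i * Ch n j - Ch n (i-1) * Ch n (j+1) := by
  induction n with
  | zero =>
    intro i j hij
    by_cases h : i = 0 ∧ j = 0
    · obtain ⟨rfl, rfl⟩ := h
      have : ∀ f, Good 0 0 0 f := by intro f; simp [Good, suf]
      have e : Nat.card {f // Good 0 0 0 f} = 1 := by
        rw [Nat.card_eq_one_iff_unique]
        exact ⟨⟨fun a b => Subtype.ext (Subsingleton.elim _ _)⟩, ⟨⟨(fun _ => true, fun _ => true), this _⟩⟩⟩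
      simp [cnt, e, Ch]
    · have e : IsEmpty {f // Good 0 i j f} := by
        constructor
        rintro ⟨f, h1, h2, h3⟩
        simp [suf] at h1 h2
        omega
      have hz : ∀ k : ℤ, Ch 0 k = if k = 0 then 1 else 0 := by
        intro k
        unfold Ch
        rcases lt_trichotomy k 0 with h | h | h
        · rw [if_pos h, if_neg (by omega)]
        · subst h; simp
        · rw [if_neg (by omega), if_neg (by omega), Nat.choose_eq_zero_of_lt (by omega)]; simp
      simp only [cnt, Nat.card_of_isEmpty, hz]
      split_ifs <;> omega
  | succ n ih =>
    intro i j hij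
    rcases eq_or_lt_of_le hij with h | h
    · subst h
      have e : IsEmpty {f // Good (n+1) (j+1) j f} := by
        constructor
        rintro ⟨f, h1, h2, h3⟩
        have := h3 0
        omega
      simp only [cnt, Nat.card_of_isEmpty]
      simp; ring
    · rw [cnt_succ n i j (by omega), ih i j hij, ih (i-1) j (by omega), ih i (j-1) (by omega),
        ih (i-1) (j-1) (by omega), Ch_succ n i, Ch_succ n j, Ch_succ n (i-1), Ch_succ n (j+1)]
      simp only [sub_add_cancel, add_sub_cancel_right]
      ring

/-! ### lengths -/

lemma inv_split {n : ℕ} (w : Equiv.Perm (Fin n)) (σ : Equiv.Perm (Fin n)) :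
    invCount w = (Finset.univ.filter fun p : Fin n × Fin n =>
        (p.1 < p.2 ∧ w p.2 < w p.1) ∧ σ p.1 < σ p.2).card +
      (Finset.univ.filter fun p : Fin n × Fin n =>
        (p.1 < p.2 ∧ w p.2 < w p.1) ∧ ¬ σ p.1 < σ p.2).card := by
  unfold invCount
  rw [← Finset.card_filter_add_card_filter_not (fun p : Fin n × Fin n => σ p.1 < σ p.2),
    Finset.filter_filter, Finset.filter_filter]

lemma inv_main {n : ℕ} (w : Equiv.Perm (Fin n)) (p q : Fin n) :
    (Finset.univ.filter fun x : Fin n × Fin n =>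
        (x.1 < x.2 ∧ w x.2 < w x.1) ∧ swap p q x.1 < swap p q x.2).card =
    (Finset.univ.filter fun x : Fin n × Fin n =>
        (x.1 < x.2 ∧ (w * swap p q) x.2 < (w * swap p q) x.1) ∧ swap p q x.1 < swap p q x.2).card := by
  apply Finset.card_nbij' (fun x => (swap p q x.1, swap p q x.2)) (fun x => (swap p q x.1, swap p q x.2))
  · intro x hx
    simp only [mem_coe, mem_filter, mem_univ, true_and] at hx ⊢
    simp only [Perm.mul_apply, swap_apply_self]
    tauto
  · intro x hx
    simp only [mem_coe, mem_filter, mem_univ, true_and] at hx ⊢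
    simp only [Perm.mul_apply, swap_apply_self] at hx ⊢
    tauto
  · intro x; simp
  · intro x; simp

lemma inv_E {n : ℕ} (p q x y : Fin n) (hpq : p < q) (hxy : x < y) (h : ¬ swap p q x < swap p q y) :
    (x = p ∧ y = q) ∨ (x = p ∧ y < q) ∨ (p < x ∧ y = q) := by
  rw [swap_apply_def, swap_apply_def] at h
  split_ifs at h <;> simp_all <;> omega

lemma length_cover {n : ℕ} (w : Equiv.Perm (Fin n)) (p q : Fin n) (hpq : p < q) (hw : w p < w q)
    (hb : ∀ z, p < z → z < q → ¬ (w p < w z ∧ w z < w q)) :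
    invCount (w * swap p q) = invCount w + 1 := by
  rw [inv_split w (swap p q), inv_split (w * swap p q) (swap p q), ← inv_main, add_assoc]
  congr 1
  rw [← Finset.card_insert_of_notMem (a := (p,q))
    (s := Finset.univ.filter fun x : Fin n × Fin n =>
        (x.1 < x.2 ∧ w x.2 < w x.1) ∧ ¬ swap p q x.1 < swap p q x.2)]
  · congr 1
    ext ⟨x, y⟩
    simp only [mem_filter, mem_univ, true_and, mem_insert, Prod.mk.injEq]
    simp only [Perm.mul_apply]
    constructor
    · rintro ⟨⟨h1, h2⟩, h3⟩
      rcases inv_E p q x y hpq h1 h3 with ⟨rfl, rfl⟩ | ⟨rfl, h⟩ | ⟨h, rfl⟩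
      · simp
      · right
        refine ⟨⟨h1, ?_⟩, h3⟩
        rw [swap_apply_left, swap_apply_of_ne_of_ne h1.ne' h.ne] at h2
        have := hb y h1 h
        have : w y ≠ w x := fun e => h1.ne' (w.injective e)
        omega
      · right
        refine ⟨⟨h1, ?_⟩, h3⟩
        rw [swap_apply_right, swap_apply_of_ne_of_ne h.ne' h1.ne] at h2
        have := hb x h h1
        have : w x ≠ w y := fun e => h1.ne (w.injective e)
        omega
    · rintro (⟨rfl, rfl⟩ | ⟨⟨h1, h2⟩, h3⟩)
      · simp [hpq, hw, hpq.le]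
      · refine ⟨⟨h1, ?_⟩, h3⟩
        rcases inv_E p q x y hpq h1 h3 with ⟨rfl, rfl⟩ | ⟨rfl, h⟩ | ⟨h, rfl⟩
        · omega
        · rw [swap_apply_left, swap_apply_of_ne_of_ne h1.ne' h.ne]; omega
        · rw [swap_apply_right, swap_apply_of_ne_of_ne h.ne' h1.ne]; omega
  · simp only [mem_filter, mem_univ, true_and]; omega

lemma length_not_cover {n : ℕ} (w : Equiv.Perm (Fin n)) (p q : Fin n) (hpq : p < q) (hw : w p < w q)
    (z : Fin n) (hz1 : p < z) (hz2 : z < q) (hz3 : w p < w z) (hz4 : w z < w q) :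
    invCount (w * swap p q) ≠ invCount w + 1 := by
  rw [inv_split w (swap p q), inv_split (w * swap p q) (swap p q), ← inv_main, add_assoc]
  apply ne_of_gt
  apply Nat.add_lt_add_left
  rw [Nat.lt_iff_add_one_le]
  rw [← Finset.card_insert_of_notMem (a := (p,q))
    (s := Finset.univ.filter fun x : Fin n × Fin n =>
        (x.1 < x.2 ∧ w x.2 < w x.1) ∧ ¬ swap p q x.1 < swap p q x.2)]
  · rw [← Finset.card_insert_of_notMem (a := (p,z))]
    · apply Finset.card_le_card
      rintro ⟨x, y⟩
      simp only [mem_filter, mem_univ, true_and, mem_insert, Prod.mk.injEq]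
      simp only [Perm.mul_apply]
      rintro (⟨rfl, rfl⟩ | ⟨rfl, rfl⟩ | ⟨⟨h1, h2⟩, h3⟩)
      · rw [swap_apply_left, swap_apply_of_ne_of_ne hz1.ne' hz2.ne]; 
        refine ⟨⟨hz1, hz4⟩, by omega⟩
      · simp [hpq, hw, hpq.le]
      · refine ⟨⟨h1, ?_⟩, h3⟩
        rcases inv_E p q x y hpq h1 h3 with ⟨rfl, rfl⟩ | ⟨rfl, h⟩ | ⟨h, rfl⟩
        · omega
        · rw [swap_apply_left, swap_apply_of_ne_of_ne h1.ne' h.ne]; omega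
        · rw [swap_apply_right, swap_apply_of_ne_of_ne h.ne' h1.ne]; omega
    · simp only [mem_filter, mem_univ, true_and, mem_insert, Prod.mk.injEq]; omega
  · simp only [mem_filter, mem_univ, true_and]; omega

/-! ### Reformulation of normality -/

lemma length_swap {n : ℕ} (w : Equiv.Perm (Fin n)) (a b : Fin n) (hab : a < b)
    (hp : w.symm a < w.symm b) :
    invCount (swap a b * w) = invCount w + 1 ↔
      ∀ x, a < x → x < b → ¬ (w.symm a < w.symm x ∧ w.symm x < w.symm b) := by
  have e : swap a b * w = w * swap (w.symm a) (w.symm b) := by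
    rw [Equiv.mul_swap_eq_swap_mul]; simp
  rw [e]
  constructor
  · intro h x h1 h2 ⟨h3, h4⟩
    exact length_not_cover w _ _ hp (by simpa using hab) (w.symm x) h3 h4 (by simpa using h1)
      (by simpa using h2) h
  · intro h
    apply length_cover w _ _ hp (by simpa using hab)
    intro z h1 h2 h3
    simp only [apply_symm_apply] at h3
    exact h (w z) h3.1 h3.2 (by simpa using ⟨h1, h2⟩)

def Nrm {n d : ℕ} (i j : ℕ) (w : Equiv.Perm (Fin n)) (t : Fin d → Fin n × Fin n) : Prop :=
  (∀ k, (t k).1 < (t k).2) ∧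
  (∀ k x, (t k).1 < x → x < (t k).2 →
    ¬ (w.symm (t k).1 < w.symm x ∧ w.symm x < w.symm (t k).2)) ∧
  (∀ k k' : Fin d, k < k' → (t k).2 < (t k').2) ∧
  d ≤ i ∧ j + d ≤ n ∧
  (∀ k : Fin d, (w.symm (t k).1 : ℕ) = i - d + k) ∧
  (∀ k : Fin d, (w.symm (t k).2 : ℕ) = j + (d - 1 - (k : ℕ))) ∧
  (∀ p q : Fin n, p < q → (q : ℕ) < i - d → w q < w p) ∧
  (∀ p q : Fin n, i ≤ (p : ℕ) → p < q → (q : ℕ) < j → w q < w p) ∧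
  (∀ p q : Fin n, j + d ≤ (p : ℕ) → p < q → w q < w p)

lemma mem_firstSet {n : ℕ} (w : Equiv.Perm (Fin n)) (i : ℕ) (x : Fin n) :
    x ∈ firstSet w i ↔ (w.symm x : ℕ) < i := by
  unfold firstSet
  simp only [mem_image, mem_filter, mem_univ, true_and]
  constructor
  · rintro ⟨a, h, rfl⟩; simpa using h
  · intro h; exact ⟨w.symm x, h, by simp⟩

lemma mono_list {n d : ℕ} (i j : ℕ) (hij : i < j) (w : Equiv.Perm (Fin n))
    (t : Fin d → Fin n × Fin n) (h : Nrm i j w t) (l : List (Fin d)) (hl : l.Nodup) :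
    invCount ((l.map fun k => Equiv.swap (t k).1 (t k).2).prod * w) = invCount w + l.length := by
  obtain ⟨h1, h2, h3, h4, h5, h6, h7, -, -, -⟩ := h
  have key : ∀ (k k' : Fin d), k ≠ k' → ∀ y,
      ((w.symm (t k).1 < w.symm (swap (t k').1 (t k').2 y) ∧
        w.symm (swap (t k').1 (t k').2 y) < w.symm (t k).2) ↔
      (w.symm (t k).1 < w.symm y ∧ w.symm y < w.symm (t k).2)) := by
    intro k k' hk y
    have a1 := h6 k
    have a2 := h6 k'
    have a3 := h7 k
    have a4 := h7 k'
    have hk' : (k : ℕ) ≠ k' := fun e => hk (Fin.ext e)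
    have := k.2
    have := k'.2
    rw [swap_apply_def]
    split_ifs with e1 e2
    · subst e1; simp only [Fin.lt_def]; omega
    · subst e2; simp only [Fin.lt_def]; omega
    · rfl
  have ne : ∀ (k k' : Fin d), k ≠ k' → (t k).1 ≠ (t k').1 ∧ (t k).1 ≠ (t k').2 ∧
      (t k).2 ≠ (t k').1 ∧ (t k).2 ≠ (t k').2 := by
    intro k k' hk
    have a1 := h6 k
    have a2 := h6 k'
    have a3 := h7 k
    have a4 := h7 k'
    have hk' : (k : ℕ) ≠ k' := fun e => hk (Fin.ext e)
    have := k.2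
    have := k'.2
    refine ⟨?_, ?_, ?_, ?_⟩ <;> intro e <;> have e2 := congrArg (fun z => (w.symm z : ℕ)) e <;> omega
  induction l with
  | nil => simp
  | cons k l ih =>
    rw [List.nodup_cons] at hl
    obtain ⟨hkl, hl⟩ := hl
    specialize ih hl
    rw [List.map_cons, List.prod_cons, mul_assoc, List.length_cons, ← add_assoc, ← ih]
    set P := (l.map fun k => Equiv.swap (t k).1 (t k).2).prod with hP
    have fix : ∀ l : List (Fin d), k ∉ l →
        ((l.map fun k => Equiv.swap (t k).1 (t k).2).prod.symm (t k).1 = (t k).1 ∧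
        (l.map fun k => Equiv.swap (t k).1 (t k).2).prod.symm (t k).2 = (t k).2) ∧
        ∀ y, ((w.symm (t k).1 < w.symm ((l.map fun k => Equiv.swap (t k).1 (t k).2).prod.symm y) ∧
        w.symm ((l.map fun k => Equiv.swap (t k).1 (t k).2).prod.symm y) < w.symm (t k).2) ↔
      (w.symm (t k).1 < w.symm y ∧ w.symm y < w.symm (t k).2)) := by
      intro l
      induction l with
      | nil => intro _; exact ⟨⟨rfl, rfl⟩, fun y => Iff.rfl⟩
      | cons k' l ih2 =>
        intro hk
        rw [List.mem_cons, not_or] at hk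
        obtain ⟨⟨i1, i2⟩, i3⟩ := ih2 hk.2
        have n4 := ne k k' hk.1
        have e : ∀ y, ((k' :: l).map fun k => Equiv.swap (t k).1 (t k).2).prod.symm y =
            (l.map fun k => Equiv.swap (t k).1 (t k).2).prod.symm (swap (t k').1 (t k').2 y) := by
          intro y
          rw [List.map_cons, List.prod_cons]
          rw [← Perm.inv_def, mul_inv_rev, Perm.mul_apply, swap_inv]; rfl
        refine ⟨⟨?_, ?_⟩, ?_⟩
        · rw [e, swap_apply_of_ne_of_ne n4.1 n4.2.1, i1]
        · rw [e, swap_apply_of_ne_of_ne n4.2.2.1 n4.2.2.2, i2]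
        · intro y
          rw [e, i3, key k k' hk.1]
    obtain ⟨⟨i1, i2⟩, i3⟩ := fix l hkl
    have es : ∀ y, (P * w).symm y = w.symm (P.symm y) := fun y => rfl
    rw [length_swap (P * w) _ _ (h1 k)]
    · intro x hx1 hx2
      rw [es, es, es, i1, i2, i3]
      exact h2 k x hx1 hx2
    · rw [es, es, i1, i2, Fin.lt_def, h6, h7]
      have := k.2
      omega

lemma ijNormal_iff {n d : ℕ} (i j : ℕ) (hij : i < j) (w : Equiv.Perm (Fin n))
    (t : Fin d → Fin n × Fin n) : IJNormal i j w t ↔ Nrm i j w t := by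
  constructor
  · rintro ⟨⟨h0, h0'⟩, hm, e1, e2, h3, h4, h5, h6, h7, h8⟩
    refine ⟨h0, ?_, h3, h4, h5, h6, h7, h8⟩
    intro k
    have := hm {k}
    simp only [sL, sort_singleton, List.map_cons, List.map_nil, List.prod_cons, List.prod_nil,
      mul_one, card_singleton] at this
    refine (length_swap w _ _ (h0 k) ?_).1 this
    rw [Fin.lt_def, h6, h7]
    have := k.2
    omega
  · intro h
    obtain ⟨h1, h2, h3, h4, h5, h6, h7, h8⟩ := id h
    refine ⟨⟨h1, ?_⟩, ?_, ?_, ?_, h3, h4, h5, h6, h7, h8⟩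
    · intro k k' hk
      have a1 := h6 k
      have a2 := h6 k'
      have a3 := h7 k
      have a4 := h7 k'
      have hk' : (k : ℕ) ≠ k' := fun e => hk (Fin.ext e)
      have := k.2
      have := k'.2
      ext x
      simp only [Set.mem_inter_iff, Set.mem_insert_iff, Set.mem_singleton_iff,
        Set.mem_empty_iff_false, iff_false]
      rintro ⟨rfl | rfl, e | e⟩ <;> have e2 := congrArg (fun z => (w.symm z : ℕ)) e <;> omega
    · intro L
      have := mono_list i j hij w t h (L.sort (· ≤ ·)) (Finset.sort_nodup _ _)
      rwa [Finset.length_sort] at this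
    · intro k
      left
      have := k.2
      rw [mem_firstSet, mem_firstSet, h6, h7]
      omega
    · intro k
      left
      have := k.2
      rw [mem_firstSet, mem_firstSet, h6, h7]
      omega

/-! ### Matching of a lattice path -/

def Mt (h : ℕ → ℤ) (a b : ℕ) : Prop :=
  a < b ∧ h (b+1) = h a ∧ ∀ y, a < y → y ≤ b → h a < h y

lemma Mt_exists (h : ℕ → ℤ) (hs : ∀ y, h y - 1 ≤ h (y+1)) (n a : ℕ) (ha : a < n)
    (hn : h n ≤ h a) (h1 : h a < h (a+1)) : ∃ b, Mt h a b := by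
  classical
  have ex : ∃ b, a < b ∧ h (b+1) ≤ h a := by
    refine ⟨n-1, ?_, ?_⟩
    · by_contra hc
      have : n = a + 1 := by omega
      subst this; omega
    · rwa [Nat.sub_add_cancel (by omega)]
  obtain ⟨s1, s2⟩ := Nat.find_spec ex
  have s3 := fun m (hm : m < Nat.find ex) => Nat.find_min ex hm
  set b := Nat.find ex
  have low : ∀ y, a < y → y ≤ b → h a < h y := by
    intro y hy1 hy2
    by_cases e : y = a + 1
    · rw [e]; exact h1
    · have := s3 (y-1) (by omega)
      rw [Nat.sub_add_cancel (by omega)] at this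
      by_contra hc
      exact this ⟨by omega, by omega⟩
  refine ⟨b, s1, ?_, low⟩
  have := low b s1 le_rfl
  have := hs b
  omega

lemma Mt_fun {h : ℕ → ℤ} {a b b' : ℕ} (h1 : Mt h a b) (h2 : Mt h a b') : b = b' := by
  obtain ⟨a1, a2, a3⟩ := h1
  obtain ⟨b1, b2, b3⟩ := h2
  rcases lt_trichotomy b b' with e | e | e
  · have := b3 (b+1) (by omega) (by omega); omega
  · exact e
  · have := a3 (b'+1) (by omega) (by omega); omega

lemma Mt_inj {h : ℕ → ℤ} {a a' b : ℕ} (h1 : Mt h a b) (h2 : Mt h a' b) : a = a' := by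
  obtain ⟨a1, a2, a3⟩ := h1
  obtain ⟨b1, b2, b3⟩ := h2
  rcases lt_trichotomy a a' with e | e | e
  · have := a3 a' (by omega) (by omega); omega
  · exact e
  · have := b3 a (by omega) (by omega); omega

lemma Mt_nc {h : ℕ → ℤ} {a b a' b' : ℕ} (h1 : Mt h a b) (h2 : Mt h a' b') (h3 : a < a')
    (h4 : a' ≤ b) : b' ≤ b := by
  obtain ⟨a1, a2, a3⟩ := h1
  obtain ⟨b1, b2, b3⟩ := h2
  by_contra hc
  have := b3 (b+1) (by omega) (by omega)
  have := a3 a' h3 h4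
  omega

lemma Mt_under {h : ℕ → ℤ} (hs : ∀ y, h (y+1) ≤ h y + 1) {a b y : ℕ} (h1 : Mt h a b)
    (h2 : a < y) (h3 : y < b) (h4 : h (y+1) < h y) : ∃ a', Mt h a' y := by
  classical
  obtain ⟨a1, a2, a3⟩ := h1
  have hy := a3 (y+1) (by omega) (by omega)
  let P := fun a' => a' < y ∧ h a' ≤ h (y+1)
  have hPa : P a := ⟨h2, by omega⟩
  have g1 : P (Nat.findGreatest P y) := Nat.findGreatest_spec h2.le hPa
  have g2 : ∀ k, Nat.findGreatest P y < k → k ≤ y → ¬ P k :=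
    fun k hk hk' => Nat.findGreatest_is_greatest hk hk'
  set c := Nat.findGreatest P y
  have low : ∀ z, c < z → z ≤ y → h (y+1) < h z := by
    intro z hz1 hz2
    by_cases e : z = y
    · rw [e]; exact h4
    · by_contra hc
      exact g2 z hz1 hz2 ⟨by omega, by omega⟩
  have e1 := low (c+1) (by omega) (by have := g1.1; omega)
  have e2 := hs c
  have e3 := g1.2
  have e4 : h (y+1) = h c := by omega
  exact ⟨c, g1.1, e4, fun z hz1 hz2 => by rw [← e4]; exact low z hz1 hz2⟩

/-! ### Height function and sorting key of a pair of subsets -/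

lemma suf_step {n : ℕ} (f : Fin n → Bool) (x : Fin n) :
    suf f x = suf f (x+1) + if f x = true then 1 else 0 := by
  unfold suf
  rw [← Finset.sum_ite_eq_of_mem (s := Finset.univ) x (fun y => if f y = true then (1:ℤ) else 0)
    (mem_univ x), ← Finset.sum_add_distrib]
  apply Finset.sum_congr rfl
  intro y _
  by_cases e : x = y
  · subst e; simp
  · have : (x : ℕ) ≠ y := fun h => e (Fin.ext h)
    have e2 : ((x : ℕ) ≤ y) ↔ ((x : ℕ) + 1 ≤ y) := by omega
    simp [e, e2]

lemma suf_ge {n : ℕ} (f : Fin n → Bool) (m : ℕ) (h : n ≤ m) : suf f m = 0 := by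
  unfold suf
  apply Finset.sum_eq_zero
  intro x _
  rw [if_neg]
  have := x.2
  omega

def ht {n : ℕ} (f g : Fin n → Bool) (m : ℕ) : ℤ := suf g m - suf f m

lemma ht_step {n : ℕ} (f g : Fin n → Bool) (x : Fin n) :
    ht f g (x+1) = ht f g x + (if f x = true then 1 else 0) - (if g x = true then 1 else 0) := by
  unfold ht
  rw [suf_step f x, suf_step g x]; ring

lemma ht_ge {n : ℕ} (f g : Fin n → Bool) (m : ℕ) (h : n ≤ m) : ht f g m = 0 := by
  unfold ht; rw [suf_ge _ _ h, suf_ge _ _ h]; rfl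

lemma ht_up {n : ℕ} (f g : Fin n → Bool) (y : ℕ) (h : ht f g y < ht f g (y+1)) :
    ∃ hy : y < n, f ⟨y, hy⟩ = true ∧ g ⟨y, hy⟩ = false := by
  by_cases hy : y < n
  · have := ht_step f g ⟨y, hy⟩
    simp only at this
    refine ⟨hy, ?_⟩
    split_ifs at this <;> simp_all <;> omega
  · rw [ht_ge _ _ _ (by omega), ht_ge _ _ _ (by omega)] at h; omega

lemma ht_down {n : ℕ} (f g : Fin n → Bool) (y : ℕ) (h : ht f g (y+1) < ht f g y) :
    ∃ hy : y < n, f ⟨y, hy⟩ = false ∧ g ⟨y, hy⟩ = true := by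
  by_cases hy : y < n
  · have := ht_step f g ⟨y, hy⟩
    simp only at this
    refine ⟨hy, ?_⟩
    split_ifs at this <;> simp_all <;> omega
  · rw [ht_ge _ _ _ (by omega), ht_ge _ _ _ (by omega)] at h; omega

lemma ht_le {n : ℕ} (f g : Fin n → Bool) (y : ℕ) :
    ht f g y - 1 ≤ ht f g (y+1) ∧ ht f g (y+1) ≤ ht f g y + 1 := by
  by_cases hy : y < n
  · have := ht_step f g ⟨y, hy⟩
    simp only at this
    split_ifs at this <;> omega
  · rw [ht_ge _ _ _ (by omega), ht_ge _ _ _ (by omega)]; omega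

lemma Mt_left {n : ℕ} {f g : Fin n → Bool} {a b : ℕ} (h : Mt (ht f g) a b) :
    ∃ hy : a < n, f ⟨a, hy⟩ = true ∧ g ⟨a, hy⟩ = false :=
  ht_up f g a (h.2.2 _ (by omega) (by have := h.1; omega))

lemma Mt_right {n : ℕ} {f g : Fin n → Bool} {a b : ℕ} (h : Mt (ht f g) a b) :
    ∃ hy : b < n, f ⟨b, hy⟩ = false ∧ g ⟨b, hy⟩ = true :=
  ht_down f g b (by rw [h.2.1]; exact h.2.2 _ h.1 le_rfl)

open Classical in
def mate {n : ℕ} (f g : Fin n → Bool) (a : ℕ) : ℕ :=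
  if h : ∃ b, Mt (ht f g) a b then h.choose else 0

lemma mate_eq {n : ℕ} {f g : Fin n → Bool} {a b : ℕ} (h : Mt (ht f g) a b) :
    mate f g a = b := by
  unfold mate
  have ex : ∃ b, Mt (ht f g) a b := ⟨b, h⟩
  rw [dif_pos ex]
  exact Mt_fun ex.choose_spec h

open Classical in
def blk {n : ℕ} (f g : Fin n → Bool) (x : Fin n) : ℕ :=
  if f x = true then (if g x = true then 0 else 1)
  else if g x = true then (if ∃ a, Mt (ht f g) a x then 3 else 2) else 4

def inner {n : ℕ} (f g : Fin n → Bool) (x : Fin n) : ℕ :=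
  if f x = true ∧ g x = false then mate f g x else n - 1 - x

lemma inner_lt {n : ℕ} (f g : Fin n → Bool) (x : Fin n) : inner f g x < n := by
  have := x.2
  unfold inner
  split_ifs with h
  · by_cases ex : ∃ b, Mt (ht f g) x b
    · obtain ⟨b, hb⟩ := ex
      rw [mate_eq hb]
      exact (Mt_right hb).1
    · unfold mate; rw [dif_neg ex]; omega
  · omega

def key {n : ℕ} (f g : Fin n → Bool) (x : Fin n) : ℕ := blk f g x * n + inner f g x

lemma key_lt {n : ℕ} (f g : Fin n → Bool) (x y : Fin n) :
    key f g x < key f g y ↔ blk f g x < blk f g y ∨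
      (blk f g x = blk f g y ∧ inner f g x < inner f g y) := by
  have h1 := inner_lt f g x
  have h2 := inner_lt f g y
  unfold key
  have aux : ∀ a b : ℕ, a < b → a * n + n ≤ b * n := by
    intro a b h
    calc a * n + n = (a+1) * n := by ring
      _ ≤ b * n := Nat.mul_le_mul_right n h
  rcases lt_trichotomy (blk f g x) (blk f g y) with h | h | h
  · have := aux _ _ h; omega
  · rw [h]; omega
  · have := aux _ _ h; omega

/-! ### From data to pairs -/

def Fm {n : ℕ} (i : ℕ) (w : Equiv.Perm (Fin n)) : Fin n → Bool :=
  fun x => decide ((w.symm x : ℕ) < i)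
def Gm {n : ℕ} (i j d : ℕ) (w : Equiv.Perm (Fin n)) : Fin n → Bool :=
  fun x => decide ((w.symm x : ℕ) < i - d ∨ (i ≤ (w.symm x : ℕ) ∧ (w.symm x : ℕ) < j + d))

lemma sum_pos {n : ℕ} (w : Equiv.Perm (Fin n)) (l u : ℕ) (hlu : l ≤ u) (hu : u ≤ n) :
    (∑ x : Fin n, if l ≤ (w.symm x : ℕ) ∧ (w.symm x : ℕ) < u then (1:ℤ) else 0) = u - l := by
  rw [Equiv.sum_comp w.symm (fun p : Fin n => if l ≤ (p : ℕ) ∧ (p : ℕ) < u then (1:ℤ) else 0),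
    Fin.sum_univ_eq_sum_range (fun p => if l ≤ p ∧ p < u then (1:ℤ) else 0) n,
    ← Finset.sum_filter]
  have : (Finset.range n).filter (fun p => l ≤ p ∧ p < u) = Finset.Ico l u := by
    ext p; simp; omega
  rw [this]; simp [hlu]

section data
variable {n d i j : ℕ} {w : Equiv.Perm (Fin n)} {t : Fin d → Fin n × Fin n}

lemma exists_a (h : Nrm i j w t) (x : Fin n) (h1 : i - d ≤ (w.symm x : ℕ))
    (h2 : (w.symm x : ℕ) < i) : ∃ k, x = (t k).1 := by
  obtain ⟨-, -, -, h4, -, h6, -⟩ := h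
  refine ⟨⟨w.symm x - (i - d), by omega⟩, w.symm.injective (Fin.ext ?_)⟩
  rw [h6]; simp only; omega

lemma exists_b (h : Nrm i j w t) (x : Fin n) (h1 : j ≤ (w.symm x : ℕ))
    (h2 : (w.symm x : ℕ) < j + d) : ∃ k, x = (t k).2 := by
  obtain ⟨-, -, -, h4, -, h6, h7, -⟩ := h
  refine ⟨⟨d - 1 - (w.symm x - j), by omega⟩, w.symm.injective (Fin.ext ?_)⟩
  rw [h7]; simp only; omega

lemma ht_datum (hij : i < j) (h : Nrm i j w t) (y : ℕ) :
    ht (Fm i w) (Gm i j d w) y =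
      (∑ k : Fin d, if ((t k).1 : ℕ) < y ∧ y ≤ ((t k).2 : ℕ) then (1:ℤ) else 0) +
      ∑ x : Fin n, if y ≤ (x : ℕ) ∧ i ≤ (w.symm x : ℕ) ∧ (w.symm x : ℕ) < j then (1:ℤ) else 0 := by
  obtain ⟨h1, h2, h3, h4, h5, h6, h7, h8⟩ := id h
  have ab : ∀ k : Fin d, (if ((t k).1 : ℕ) < y ∧ y ≤ ((t k).2 : ℕ) then (1:ℤ) else 0) =
      (∑ x : Fin n, if y ≤ (x : ℕ) ∧ x = (t k).2 then (1:ℤ) else 0) -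
      ∑ x : Fin n, if y ≤ (x : ℕ) ∧ x = (t k).1 then (1:ℤ) else 0 := by
    intro k
    have e : ∀ c : Fin n, (∑ x : Fin n, if y ≤ (x : ℕ) ∧ x = c then (1:ℤ) else 0) =
        if y ≤ (c : ℕ) then 1 else 0 := by
      intro c
      rw [Finset.sum_eq_single c]
      · simp
      · intro b _ hb; simp [hb]
      · simp
    rw [e, e]
    have := h1 k
    rw [Fin.lt_def] at this
    split_ifs <;> omega
  simp only [ab]
  rw [Finset.sum_sub_distrib, Finset.sum_comm, Finset.sum_comm (s := (univ : Finset (Fin d)))]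
  unfold ht suf
  rw [← Finset.sum_sub_distrib, ← Finset.sum_sub_distrib, ← Finset.sum_add_distrib]
  apply Finset.sum_congr rfl
  intro x _
  have eb : (∑ k : Fin d, if y ≤ (x : ℕ) ∧ x = (t k).2 then (1:ℤ) else 0) =
      if y ≤ (x:ℕ) ∧ j ≤ (w.symm x : ℕ) ∧ (w.symm x : ℕ) < j + d then 1 else 0 := by
    split_ifs with hc
    · obtain ⟨k, hk⟩ := exists_b h x hc.2.1 hc.2.2
      rw [Finset.sum_eq_single k]
      · rw [if_pos ⟨hc.1, hk⟩]
      · intro b _ hb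
        rw [if_neg]
        rintro ⟨_, e⟩
        rw [hk] at e
        have e2 := congrArg (fun z => (w.symm z : ℕ)) e
        simp only [h7] at e2
        exact hb (Fin.ext (by omega))
      · simp
    · apply Finset.sum_eq_zero
      intro k _
      rw [if_neg]
      rintro ⟨h, rfl⟩
      apply hc
      rw [h7]
      have := k.2
      omega
  have ea : (∑ k : Fin d, if y ≤ (x : ℕ) ∧ x = (t k).1 then (1:ℤ) else 0) =
      if y ≤ (x:ℕ) ∧ i - d ≤ (w.symm x : ℕ) ∧ (w.symm x : ℕ) < i then 1 else 0 := by
    split_ifs with hc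
    · obtain ⟨k, hk⟩ := exists_a h x hc.2.1 hc.2.2
      rw [Finset.sum_eq_single k]
      · rw [if_pos ⟨hc.1, hk⟩]
      · intro b _ hb
        rw [if_neg]
        rintro ⟨_, e⟩
        rw [hk] at e
        have e2 := congrArg (fun z => (w.symm z : ℕ)) e
        simp only [h6] at e2
        exact hb (Fin.ext (by omega))
      · simp
    · apply Finset.sum_eq_zero
      intro k _
      rw [if_neg]
      rintro ⟨h, rfl⟩
      apply hc
      rw [h6]
      have := k.2
      omega
  rw [ea, eb]
  simp only [Fm, Gm, decide_eq_true_eq]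
  split_ifs <;> omega

lemma nc_datum (hij : i < j) (h : Nrm i j w t) (k k' : Fin d) (hk : k ≠ k')
    (h1 : (t k').1 < (t k).1) (h2 : (t k).1 ≤ (t k').2) : (t k).2 < (t k').2 := by
  obtain ⟨a1, a2, a3, a4, a5, a6, a7, a8⟩ := id h
  rcases lt_or_gt_of_ne hk with e | e
  · exact a3 _ _ e
  · exfalso
    have hne : (t k).1 ≠ (t k').2 := by
      intro e2
      have e3 := congrArg (fun z => (w.symm z : ℕ)) e2
      simp only [a6, a7] at e3
      have := k.2
      omega
    refine a2 k' (t k).1 h1 (lt_of_le_of_ne h2 hne) ?_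
    simp only [Fin.lt_def, a6, a7]
    have := k.2
    have := k'.2
    rw [Fin.lt_def] at e
    omega

lemma nc_datum2 (hij : i < j) (h : Nrm i j w t) (k k' : Fin d) (hk : k ≠ k')
    (h1 : (t k').1 < (t k).2) (h2 : (t k).2 < (t k').2) : (t k').1 < (t k).1 := by
  obtain ⟨a1, a2, a3, a4, a5, a6, a7, a8⟩ := id h
  have e : k < k' := by
    rcases lt_or_gt_of_ne hk with e | e
    · exact e
    · exact absurd (a3 _ _ e) (by omega)
  by_contra hc
  have hne : (t k).1 ≠ (t k').1 := by
    intro e2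
    have e3 := congrArg (fun z => (w.symm z : ℕ)) e2
    simp only [a6] at e3
    exact hk (Fin.ext (by omega))
  refine a2 k (t k').1 (lt_of_le_of_ne (not_lt.1 hc) hne) h1 ?_
  simp only [Fin.lt_def, a6, a7]
  have := k.2
  have := k'.2
  rw [Fin.lt_def] at e
  omega

lemma Mt_datum (hij : i < j) (h : Nrm i j w t) (k : Fin d) :
    Mt (ht (Fm i w) (Gm i j d w)) (t k).1 (t k).2 := by
  obtain ⟨a1, a2, a3, a4, a5, a6, a7, a8⟩ := id h
  have hB : ∀ y : ℕ, ((t k).1 : ℕ) ≤ y → y ≤ ((t k).2 : ℕ) + 1 →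
      (∑ x : Fin n, if y ≤ (x : ℕ) ∧ i ≤ (w.symm x : ℕ) ∧ (w.symm x : ℕ) < j then (1:ℤ) else 0) =
      ∑ x : Fin n, if ((t k).1 : ℕ) ≤ (x : ℕ) ∧ i ≤ (w.symm x : ℕ) ∧ (w.symm x : ℕ) < j
        then (1:ℤ) else 0 := by
    intro y hy1 hy2
    apply Finset.sum_congr rfl
    intro x _
    congr 1
    apply propext
    constructor
    · rintro ⟨h1, h2⟩; exact ⟨by omega, h2⟩
    · rintro ⟨h1, h2, h3⟩
      refine ⟨?_, h2, h3⟩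
      by_contra hc
      have k2 := k.2
      have n1 : ((t k).1 : ℕ) ≠ x := by
        intro e
        have := a6 k
        rw [Fin.ext e] at this
        omega
      have n2 : (x : ℕ) ≠ (t k).2 := by
        intro e
        have := a7 k
        rw [← Fin.ext e] at this
        omega
      refine a2 k x (Fin.lt_def.2 (by omega)) (Fin.lt_def.2 (by omega)) ?_
      simp only [Fin.lt_def, a6, a7]
      omega
  have h1k := a1 k
  rw [Fin.lt_def] at h1k
  refine ⟨h1k, ?_, ?_⟩
  · rw [ht_datum hij h, ht_datum hij h, hB _ (by omega) le_rfl]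
    congr 1
    apply Finset.sum_congr rfl
    intro k' _
    congr 1
    apply propext
    by_cases e : k = k'
    · subst e; omega
    have b1 := nc_datum hij h k k' e
    have b2 := nc_datum2 hij h k k' e
    simp only [Fin.lt_def, Fin.le_def] at b1 b2
    constructor <;> intro ⟨c1, c2⟩
    · have hne : ((t k').1 : ℕ) ≠ (t k).2 := by
        intro e
        have e3 := congrArg (fun z => (w.symm z : ℕ)) (Fin.ext e)
        simp only [a6, a7] at e3
        have := k'.2
        omega
      have := b2 (by omega) (by omega)
      omega
    · have := b1 (by omega) (by omega); omega
  · intro y hy1 hy2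
    rw [ht_datum hij h, ht_datum hij h, hB y (by omega) (by omega)]
    apply add_lt_add_left
    apply Finset.sum_lt_sum
    · intro k' _
      by_cases e : k = k'
      · subst e; split_ifs <;> omega
      have b1 := nc_datum hij h k k' e
      simp only [Fin.lt_def, Fin.le_def] at b1
      by_cases c : ((t k').1 : ℕ) < (t k).1 ∧ ((t k).1 : ℕ) ≤ (t k').2
      · have := b1 c.1 c.2
        rw [if_pos c, if_pos (by omega)]
      · rw [if_neg c]; split_ifs <;> simp
    · refine ⟨k, mem_univ _, ?_⟩
      rw [if_neg (by omega), if_pos (by omega)]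
      simp

lemma good_datum (hij : i < j) (h : Nrm i j w t) :
    Good n i j (Fm i w, Gm i j d w) := by
  obtain ⟨a1, a2, a3, a4, a5, a6, a7, a8⟩ := id h
  have e1 : suf (Fm i w) 0 = i := by
    have := sum_pos w 0 i (by omega) (by omega)
    simpa [suf, Fm] using this
  have nn : ∀ y, 0 ≤ ht (Fm i w) (Gm i j d w) y := by
    intro y
    rw [ht_datum hij h]
    apply add_nonneg <;> apply Finset.sum_nonneg <;> intro x _ <;> split_ifs <;> simp
  refine ⟨e1, ?_, fun m => ?_⟩
  · have := ht_datum hij h 0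
    unfold ht at this
    have e2 := sum_pos w i j (by omega) (by omega)
    simp only [Nat.zero_le, true_and] at this
    rw [e2, e1] at this
    simp at this
    simp only; linarith
  · have := nn m
    unfold ht at this
    simp only; linarith

lemma blk_datum (hij : i < j) (h : Nrm i j w t) (x : Fin n) :
    blk (Fm i w) (Gm i j d w) x =
      if (w.symm x : ℕ) < i - d then 0 else if (w.symm x : ℕ) < i then 1 else
      if (w.symm x : ℕ) < j then 2 else if (w.symm x : ℕ) < j + d then 3 else 4 := by
  obtain ⟨a1, a2, a3, a4, a5, a6, a7, a8⟩ := id h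
  unfold blk
  have hm : (i ≤ (w.symm x : ℕ) ∧ (w.symm x : ℕ) < j + d) →
      ((∃ a, Mt (ht (Fm i w) (Gm i j d w)) a x) ↔ j ≤ (w.symm x : ℕ)) := by
    rintro ⟨hx1, hx2⟩
    constructor
    · rintro ⟨a, ha⟩
      obtain ⟨han, h1, h2⟩ := Mt_left ha
      simp only [Fm, Gm, decide_eq_true_eq, decide_eq_false_iff_not] at h1 h2
      obtain ⟨k, hk⟩ := exists_a h ⟨a, han⟩ (by omega) (by omega)
      have e : a = ((t k).1 : ℕ) := congrArg Fin.val hk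
      rw [e] at ha
      have := Mt_fun ha (Mt_datum hij h k)
      rw [Fin.ext this, a7]
      omega
    · intro hx
      obtain ⟨k, rfl⟩ := exists_b h x hx hx2
      exact ⟨_, Mt_datum hij h k⟩
  simp only [Fm, Gm, decide_eq_true_eq]
  split_ifs <;> first
    | omega
    | (have h9 := (hm (by omega)).1 ‹_›; omega)
    | (have h9 := (hm (by omega)).2 (by omega); contradiction)

lemma inner_datum (hij : i < j) (h : Nrm i j w t) (k : Fin d) :
    inner (Fm i w) (Gm i j d w) (t k).1 = (t k).2 := by
  obtain ⟨a1, a2, a3, a4, a5, a6, a7, a8⟩ := id h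
  unfold inner
  rw [if_pos, mate_eq (Mt_datum hij h k)]
  simp only [Fm, Gm, decide_eq_true_eq, decide_eq_false_iff_not, a6]
  have := k.2
  omega

lemma inner_datum' (x : Fin n) (hx : (w.symm x : ℕ) < i - d ∨ i ≤ (w.symm x : ℕ)) :
    inner (Fm i w) (Gm i j d w) x = n - 1 - x := by
  unfold inner
  rw [if_neg]
  simp only [Fm, Gm, decide_eq_true_eq, decide_eq_false_iff_not]
  omega

lemma key_datum (hij : i < j) (h : Nrm i j w t) (x y : Fin n) (hxy : w.symm x < w.symm y) :
    key (Fm i w) (Gm i j d w) x < key (Fm i w) (Gm i j d w) y := by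
  obtain ⟨a1, a2, a3, a4, a5, a6, a7, a8, a9, a10⟩ := id h
  rw [key_lt]
  have hx := x.2
  have hy := y.2
  have hv : (w.symm x : ℕ) < (w.symm y : ℕ) := hxy
  rw [blk_datum hij h, blk_datum hij h]
  by_cases c0 : (w.symm y : ℕ) < i - d
  · right
    have := a8 _ _ hxy c0
    simp only [apply_symm_apply, Fin.lt_def] at this
    rw [inner_datum' x (by omega), inner_datum' y (by omega), if_pos (by omega), if_pos (by omega)]
    omega
  by_cases c1 : i - d ≤ (w.symm x : ℕ) ∧ (w.symm y : ℕ) < i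
  · right
    obtain ⟨k, rfl⟩ := exists_a h x (by omega) (by omega)
    obtain ⟨k', rfl⟩ := exists_a h y (by omega) (by omega)
    rw [inner_datum hij h, inner_datum hij h]
    constructor
    · split_ifs <;> omega
    · rw [a6, a6] at hv
      exact a3 k k' (Fin.lt_def.2 (by omega))
  by_cases c2 : i ≤ (w.symm x : ℕ) ∧ (w.symm y : ℕ) < j
  · right
    have := a9 _ _ c2.1 hxy c2.2
    simp only [apply_symm_apply, Fin.lt_def] at this
    rw [inner_datum' x (by omega), inner_datum' y (by omega)]
    constructor
    · split_ifs <;> omega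
    · omega
  by_cases c3 : j ≤ (w.symm x : ℕ) ∧ (w.symm y : ℕ) < j + d
  · right
    rw [inner_datum' x (by omega), inner_datum' y (by omega)]
    constructor
    · split_ifs <;> omega
    · obtain ⟨k, rfl⟩ := exists_b h x (by omega) (by omega)
      obtain ⟨k', rfl⟩ := exists_b h y (by omega) (by omega)
      rw [a7, a7] at hv
      have := a3 k' k (Fin.lt_def.2 (by omega))
      rw [Fin.lt_def] at this
      omega
  by_cases c4 : j + d ≤ (w.symm x : ℕ)
  · right
    have := a10 _ _ c4 hxy
    simp only [apply_symm_apply, Fin.lt_def] at this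
    rw [inner_datum' x (by omega), inner_datum' y (by omega)]
    constructor
    · split_ifs <;> omega
    · omega
  left
  split_ifs <;> omega

end data

lemma perm_unique {n : ℕ} (K : Fin n → ℕ) (w w' : Equiv.Perm (Fin n))
    (h : ∀ x y, w.symm x < w.symm y → K x < K y)
    (h' : ∀ x y, w'.symm x < w'.symm y → K x < K y) : w = w' := by
  have m : ∀ w : Equiv.Perm (Fin n), (∀ x y, w.symm x < w.symm y → K x < K y) →
      StrictMono (fun p => K (w p)) := by
    intro w h p q hpq
    exact h _ _ (by simpa using hpq)
  have : (fun p => K (w p)) = fun p => K (w' p) := by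
    apply (StrictMono.range_inj (m w h) (m w' h')).1
    rw [show (fun p => K (w p)) = K ∘ w from rfl, show (fun p => K (w' p)) = K ∘ w' from rfl,
      EquivLike.range_comp, EquivLike.range_comp]
  have hK : Function.Injective K := by
    intro x y e
    by_contra hne
    have : w.symm x ≠ w.symm y := fun e2 => hne (w.symm.injective e2)
    rcases lt_or_gt_of_ne this with c | c
    · exact absurd (h _ _ c) (by omega)
    · exact absurd (h _ _ c) (by omega)
  ext p
  rw [hK (congrFun this p)]

lemma datum_inj {n d d' i j : ℕ} (hij : i < j) (w w' : Equiv.Perm (Fin n))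
    (t : Fin d → Fin n × Fin n) (t' : Fin d' → Fin n × Fin n) (h : Nrm i j w t)
    (h' : Nrm i j w' t') (hF : Fm i w = Fm i w') (hG : Gm i j d w = Gm i j d' w') :
    (⟨d, w, t⟩ : Σ d : ℕ, Equiv.Perm (Fin n) × (Fin d → Fin n × Fin n)) = ⟨d', w', t'⟩ := by
  have cd : ∀ (d : ℕ) (w : Equiv.Perm (Fin n)) (t : Fin d → Fin n × Fin n), Nrm i j w t →
      (∑ x : Fin n, if Fm i w x = true ∧ Gm i j d w x = false then (1:ℤ) else 0) = d := by
    intro d w t h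
    obtain ⟨a1, a2, a3, a4, a5, a6, a7, a8⟩ := h
    have := sum_pos w (i - d) i (by omega) (by omega)
    rw [Nat.cast_sub a4] at this
    rw [show (d : ℤ) = i - (i - d) by ring, ← this]
    apply Finset.sum_congr rfl
    intro x _
    congr 1
    apply propext
    simp only [Fm, Gm, decide_eq_true_eq, decide_eq_false_iff_not]
    omega
  have e1 := cd d w t h
  rw [hF, hG, cd d' w' t' h'] at e1
  have e2 : d' = d := by exact_mod_cast e1
  subst e2
  have e3 : w = w' := by
    apply perm_unique (key (Fm i w) (Gm i j d' w)) w w' (key_datum hij h)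
    rw [hF, hG]
    exact key_datum hij h'
  subst e3
  have e4 : t = t' := by
    obtain ⟨-, -, -, -, -, a6, a7, -⟩ := h
    obtain ⟨-, -, -, -, -, b6, b7, -⟩ := h'
    funext k
    apply Prod.ext
    · apply w.symm.injective
      apply Fin.ext
      rw [a6, b6]
    · apply w.symm.injective
      apply Fin.ext
      rw [a7, b7]
  rw [e4]

/-! ### From pairs to data -/

lemma exists_perm {n : ℕ} (K : Fin n → ℕ) (hK : Function.Injective K) :
    ∃ w : Equiv.Perm (Fin n), ∀ x, (w.symm x : ℕ) = (univ.filter fun y => K y < K x).card := by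
  have lt : ∀ x, (univ.filter fun y => K y < K x).card < n := by
    intro x
    have : (univ.filter fun y => K y < K x).card < (univ : Finset (Fin n)).card := by
      apply Finset.card_lt_card
      rw [Finset.ssubset_univ_iff]
      intro h
      have := h ▸ mem_univ x
      simp at this
    simpa using this
  let r : Fin n → Fin n := fun x => ⟨_, lt x⟩
  have mono : ∀ x y, K x < K y → r x < r y := by
    intro x y hxy
    rw [Fin.lt_def]
    change (univ.filter fun z => K z < K x).card < (univ.filter fun z => K z < K y).card
    apply Finset.card_lt_card
    rw [Finset.ssubset_iff_of_subset]
    · exact ⟨x, by simpa using hxy, by simp⟩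
    · intro z; simp; omega
  have inj : Function.Injective r := by
    intro x y e
    apply hK
    rcases lt_trichotomy (K x) (K y) with c | c | c
    · exact absurd (mono _ _ c) (by rw [e]; simp)
    · exact c
    · exact absurd (mono _ _ c) (by rw [e]; simp)
  refine ⟨(Equiv.ofBijective r (Finite.injective_iff_bijective.1 inj)).symm, fun x => ?_⟩
  rfl

lemma anti_rev (d : ℕ) (φ : ℕ → ℕ) (hφ : ∀ k, k < d → φ k < d)
    (ha : ∀ k k', k < k' → k' < d → φ k' < φ k) : ∀ k, k < d → φ k = d - 1 - k := by
  have up : ∀ k, k < d → φ k ≤ d - 1 - k := by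
    intro k
    induction k with
    | zero => intro h; have := hφ 0 h; omega
    | succ k ih => intro h; have := ih (by omega); have := ha k (k+1) (by omega) h; omega
  have dn : ∀ m k, k < d → k + m = d - 1 → m ≤ φ k := by
    intro m
    induction m with
    | zero => intros; omega
    | succ m ih =>
      intro k hk e
      have := ih (k+1) (by omega) (by omega)
      have := ha k (k+1) (by omega) (by omega)
      omega
  intro k hk
  have := up k hk
  have := dn (d - 1 - k) k hk (by omega)
  omega

lemma suf_card {n : ℕ} (f : Fin n → Bool) :
    suf f 0 = ((univ.filter fun x => f x = true).card : ℤ) := by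
  simp [suf]

lemma datum_surj {n i j : ℕ} (hij : i < j) (f g : Fin n → Bool) (hg : Good n i j (f, g)) :
    ∃ (d : ℕ) (w : Equiv.Perm (Fin n)) (t : Fin d → Fin n × Fin n), Nrm i j w t ∧
      Fm i w = f ∧ Gm i j d w = g := by
  classical
  obtain ⟨hi, hj, hb⟩ := hg
  simp only at hi hj hb
  rw [suf_card] at hi hj
  have hi' : (univ.filter fun x => f x = true).card = i := by exact_mod_cast hi
  have hj' : (univ.filter fun x => g x = true).card = j := by exact_mod_cast hj
  set H := ht f g with hH
  -- every opener is matched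
  have hM : ∀ x : Fin n, f x = true → g x = false → Mt H x (mate f g x) := by
    intro x h1 h2
    have st := ht_step f g x
    rw [if_pos h1, if_neg (by simp [h2]), ← hH] at st
    have := Mt_exists H (fun y => (ht_le f g y).1) n x x.2
      (by rw [hH, ht_ge f g n le_rfl]; have := hb x; unfold ht; omega) (by omega)
    obtain ⟨b, hb⟩ := this
    rwa [mate_eq hb]
  have blk_iff0 : ∀ x, blk f g x = 0 ↔ f x = true ∧ g x = true := by
    intro x; unfold blk; split_ifs <;> simp_all
  have blk_iff1 : ∀ x, blk f g x = 1 ↔ f x = true ∧ g x = false := by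
    intro x; unfold blk; split_ifs <;> simp_all
  have blk_iff2 : ∀ x, blk f g x = 2 ↔ f x = false ∧ g x = true ∧ ¬ ∃ a, Mt H a x := by
    intro x; unfold blk; split_ifs <;> simp_all
  have blk_iff3 : ∀ x, blk f g x = 3 ↔ f x = false ∧ g x = true ∧ ∃ a, Mt H a x := by
    intro x; unfold blk; split_ifs <;> simp_all
  have blk_iff4 : ∀ x, blk f g x = 4 ↔ f x = false ∧ g x = false := by
    intro x; unfold blk; split_ifs <;> simp_all
  have blk_le : ∀ x, blk f g x ≤ 4 := by
    intro x; unfold blk; split_ifs <;> omega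
  have inner1 : ∀ x, blk f g x = 1 → inner f g x = mate f g x := by
    intro x hx
    unfold inner
    rw [if_pos ((blk_iff1 x).1 hx)]
  have inner2 : ∀ x, blk f g x ≠ 1 → inner f g x = n - 1 - x := by
    intro x hx
    unfold inner
    rw [if_neg (fun h => hx ((blk_iff1 x).2 h))]
  have hK : Function.Injective (key f g) := by
    intro x y e
    have c1 := key_lt f g x y
    have c2 := key_lt f g y x
    have eb : blk f g x = blk f g y := by omega
    have ei : inner f g x = inner f g y := by omega
    by_cases h1 : blk f g x = 1
    · have h2 := eb ▸ h1
      rw [inner1 x h1, inner1 y h2] at ei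
      rw [blk_iff1] at h1 h2
      have m1 := hM x h1.1 h1.2
      have m2 := hM y h2.1 h2.2
      rw [ei] at m1
      exact Fin.ext (Mt_inj m1 m2)
    · rw [inner2 x h1, inner2 y (eb ▸ h1)] at ei
      have := x.2
      have := y.2
      exact Fin.ext (by omega)
  obtain ⟨w, hw⟩ := exists_perm (key f g) hK
  have pos_lt : ∀ x y, w.symm x < w.symm y ↔ key f g x < key f g y := by
    have mono : ∀ x y, key f g x < key f g y → w.symm x < w.symm y := by
      intro x y h
      rw [Fin.lt_def, hw, hw]
      apply Finset.card_lt_card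
      rw [Finset.ssubset_iff_of_subset]
      · exact ⟨x, by simpa using h, by simp⟩
      · intro z; simp; omega
    intro x y
    refine ⟨fun h => ?_, mono x y⟩
    by_contra hc
    rcases lt_or_eq_of_le (not_lt.1 hc) with c | c
    · exact absurd (mono _ _ c) (by omega)
    · rw [hK c] at h; simp at h
  have pos_blk : ∀ b x, blk f g x < b ↔
      (w.symm x : ℕ) < (univ.filter fun y => blk f g y < b).card := by
    intro b x
    constructor
    · intro h
      rw [hw]
      apply Finset.card_lt_card
      rw [Finset.ssubset_iff_of_subset]
      · exact ⟨x, by simpa using h, by simp⟩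
      · intro z hz
        simp only [mem_filter, mem_univ, true_and] at hz ⊢
        rw [key_lt] at hz
        omega
    · intro h
      by_contra hc
      apply absurd h
      rw [not_lt, hw]
      apply Finset.card_le_card
      intro z hz
      simp only [mem_filter, mem_univ, true_and] at hz ⊢
      rw [key_lt]
      omega
  -- cardinalities
  obtain ⟨d, hd⟩ : ∃ d, d = (univ.filter fun x => f x = true ∧ g x = false).card := ⟨_, rfl⟩
  have s1 : (univ.filter fun x => f x = true ∧ g x = true).card + d = i := by
    rw [hd, ← hi', ← Finset.card_filter_add_card_filter_not (s := univ.filter fun x => f x = true)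
      (fun x => g x = true), Finset.filter_filter, Finset.filter_filter]
    simp
  have s2 : (univ.filter fun x => f x = true ∧ g x = true).card +
      (univ.filter fun x => f x = false ∧ g x = true).card = j := by
    rw [← hj', ← Finset.card_filter_add_card_filter_not (s := univ.filter fun x => g x = true)
      (fun x => f x = true), Finset.filter_filter, Finset.filter_filter]
    simp [and_comm]
  have s3 : (univ.filter fun x => blk f g x = 3).card = d := by
    rw [hd]
    symm
    refine Finset.card_bij (fun x hx => ⟨mate f g x, ?_⟩) ?_ ?_ ?_
    · simp only [mem_filter, mem_univ, true_and] at hx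
      exact (Mt_right (hM x hx.1 hx.2)).1
    · intro x hx
      simp only [mem_filter, mem_univ, true_and] at hx ⊢
      have := hM x hx.1 hx.2
      obtain ⟨h1, h2, h3⟩ := Mt_right this
      exact (blk_iff3 _).2 ⟨h2, h3, _, this⟩
    · intro x hx y hy e
      simp only [mem_filter, mem_univ, true_and, Fin.mk.injEq] at hx hy e
      have m1 := hM x hx.1 hx.2
      have m2 := hM y hy.1 hy.2
      rw [e] at m1
      exact Fin.ext (Mt_inj m1 m2)
    · intro y hy
      simp only [mem_filter, mem_univ, true_and] at hy
      obtain ⟨_, _, a, ha⟩ := (blk_iff3 y).1 hy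
      obtain ⟨han, h1, h2⟩ := Mt_left ha
      exact ⟨⟨a, han⟩, by simp [h1, h2], Fin.ext (mate_eq ha)⟩
  have s4 : (univ.filter fun x => blk f g x = 2).card + d =
      (univ.filter fun x => f x = false ∧ g x = true).card := by
    rw [← s3, ← Finset.card_union_of_disjoint]
    · congr 1
      ext x
      simp only [mem_union, mem_filter, mem_univ, true_and, blk_iff2, blk_iff3]
      tauto
    · rw [Finset.disjoint_filter]; intro x _ h; omega
  have csucc : ∀ b, (univ.filter fun x => blk f g x < b + 1).card =
      (univ.filter fun x => blk f g x < b).card + (univ.filter fun x => blk f g x = b).card := by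
    intro b
    rw [← Finset.card_union_of_disjoint]
    · congr 1
      ext x
      simp only [mem_union, mem_filter, mem_univ, true_and]
      omega
    · rw [Finset.disjoint_filter]; intro x _ h; omega
  have c0 : (univ.filter fun x => blk f g x < 0).card = 0 := by simp
  have c1 := csucc 0
  have c2 := csucc 1
  have c3 := csucc 2
  have c4 := csucc 3
  simp only [blk_iff0] at c1
  simp only [blk_iff1, ← hd] at c2
  rw [s3] at c4
  simp only [zero_add, Nat.reduceAdd] at c1 c2 c3 c4
  have p1 := pos_blk 1
  have p2 := pos_blk 2
  have p3 := pos_blk 3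
  have p4 := pos_blk 4
  have q1 : (univ.filter fun x => blk f g x < 1).card = i - d := by omega
  have q2 : (univ.filter fun x => blk f g x < 2).card = i := by omega
  have q3 : (univ.filter fun x => blk f g x < 3).card = j := by omega
  have q4 : (univ.filter fun x => blk f g x < 4).card = j + d := by omega
  have q4' : j + d ≤ n := by
    rw [← q4]; exact (Finset.card_le_univ _).trans (by simp)
  have hdi : d ≤ i := by omega
  rw [q1] at p1
  rw [q2] at p2
  rw [q3] at p3
  rw [q4] at p4
  clear c0 c1 c2 c3 c4 q1 q2 q3 q4 csucc s1 s2 s3 s4 pos_blk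
  have dec : ∀ p q : Fin n, p < q → blk f g (w p) = blk f g (w q) → blk f g (w p) ≠ 1 →
      w q < w p := by
    intro p q hpq e h1
    have := (pos_lt (w p) (w q)).1 (by simpa using hpq)
    rw [key_lt, inner2 _ h1, inner2 _ (e ▸ h1)] at this
    have := (w p).2
    have := (w q).2
    rw [Fin.lt_def]
    omega
  let a : Fin d → Fin n := fun k => w ⟨i - d + k, by have := k.2; omega⟩
  have pa : ∀ k, (w.symm (a k) : ℕ) = i - d + k := by intro k; simp [a]
  have ba : ∀ k, blk f g (a k) = 1 := by
    intro k
    have := p1 (a k)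
    have := p2 (a k)
    have := pa k
    have := k.2
    omega
  have Ma : ∀ k, Mt H (a k) (mate f g (a k)) := fun k =>
    hM _ ((blk_iff1 _).1 (ba k)).1 ((blk_iff1 _).1 (ba k)).2
  let b : Fin d → Fin n := fun k => ⟨mate f g (a k), (Mt_right (Ma k)).1⟩
  have Mb : ∀ k, Mt H (a k) (b k) := Ma
  have bb : ∀ k, blk f g (b k) = 3 := by
    intro k
    obtain ⟨h1, h2, h3⟩ := Mt_right (Mb k)
    exact (blk_iff3 _).2 ⟨h2, h3, _, Mb k⟩
  have bm : ∀ k k' : Fin d, k < k' → b k < b k' := by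
    intro k k' hk
    have := (pos_lt (a k) (a k')).1 (by rw [Fin.lt_def, pa, pa]; rw [Fin.lt_def] at hk; omega)
    rw [key_lt, ba, ba, inner1 _ (ba k), inner1 _ (ba k')] at this
    rw [Fin.lt_def]
    change mate f g (a k) < mate f g (a k')
    omega
  have pb0 : ∀ k, j ≤ (w.symm (b k) : ℕ) ∧ (w.symm (b k) : ℕ) < j + d := by
    intro k
    have := p3 (b k)
    have := p4 (b k)
    have := bb k
    omega
  have pb : ∀ k, (w.symm (b k) : ℕ) = j + (d - 1 - (k : ℕ)) := by
    have := anti_rev d (fun k => if hk : k < d then (w.symm (b ⟨k, hk⟩) : ℕ) - j else 0) ?_ ?_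
    · intro k
      have t1 := this k k.2
      rw [dif_pos k.2] at t1
      have := pb0 k
      simp only [Fin.eta] at t1
      omega
    · intro k hk
      simp only [dif_pos hk]
      have := pb0 ⟨k, hk⟩
      omega
    · intro k k' hk hk'
      simp only [dif_pos hk', dif_pos (hk.trans hk')]
      have h1 := pb0 ⟨k, hk.trans hk'⟩
      have h2 := pb0 ⟨k', hk'⟩
      have h3 := bm ⟨k, hk.trans hk'⟩ ⟨k', hk'⟩ (Fin.lt_def.2 hk)
      have h4 := (pos_lt (b ⟨k', hk'⟩) (b ⟨k, hk.trans hk'⟩)).2 (by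
        rw [key_lt, inner2 _ (by rw [bb]; omega), inner2 _ (by rw [bb]; omega), bb, bb]
        have := (b ⟨k', hk'⟩).2
        rw [Fin.lt_def] at h3
        omega)
      rw [Fin.lt_def] at h4
      omega
  refine ⟨d, w, fun k => (a k, b k), ⟨?_, ?_, bm, hdi, q4', pa, pb, ?_, ?_, ?_⟩, ?_, ?_⟩
  · intro k; exact (Mb k).1
  · rintro k x h1 h2 ⟨h3, h4⟩
    simp only at h1 h2 h3 h4
    rw [pos_lt, key_lt, ba] at h3
    rw [pos_lt, key_lt, bb] at h4
    have hx : blk f g x = 1 ∨ blk f g x = 2 ∨ blk f g x = 3 := by omega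
    rcases hx with hx | hx | hx
    · rw [inner1 _ hx, inner1 _ (ba k), mate_eq (Mb k)] at h3
      have hx' := (blk_iff1 x).1 hx
      have := Mt_nc (Mb k) (hM x hx'.1 hx'.2) h1 (le_of_lt h2)
      omega
    · obtain ⟨e1, e2, e3⟩ := (blk_iff2 x).1 hx
      apply e3
      apply Mt_under (fun y => (ht_le f g y).2) (Mb k) h1 h2
      have := ht_step f g x
      rw [if_neg (by simp [e1]), if_pos e2] at this
      omega
    · rw [inner2 _ (by omega), inner2 _ (by rw [bb]; omega)] at h4
      rw [Fin.lt_def] at h2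
      have := (b k).2
      omega
  · intro p q hpq hq
    have h1 := p1 (w p)
    have h2 := p1 (w q)
    simp only [symm_apply_apply] at h1 h2
    rw [Fin.lt_def] at hpq
    exact dec p q hpq (by omega) (by omega)
  · intro p q hp hpq hq
    have h1 := p2 (w p)
    have h2 := p2 (w q)
    have h3 := p3 (w p)
    have h4 := p3 (w q)
    simp only [symm_apply_apply] at h1 h2 h3 h4
    rw [Fin.lt_def] at hpq
    exact dec p q hpq (by omega) (by omega)
  · intro p q hp hpq
    have h1 := p4 (w p)
    have h2 := p4 (w q)
    have h3 := blk_le (w p)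
    have h4 := blk_le (w q)
    simp only [symm_apply_apply] at h1 h2
    rw [Fin.lt_def] at hpq
    exact dec p q hpq (by omega) (by omega)
  · funext x
    rw [Bool.eq_iff_iff]
    simp only [Fm, decide_eq_true_eq]
    rw [← p2 x]
    unfold blk; split_ifs <;> simp_all
  · funext x
    rw [Bool.eq_iff_iff]
    simp only [Gm, decide_eq_true_eq]
    rw [← p1 x, ← p4 x, ← not_lt, ← p2 x]
    unfold blk; split_ifs <;> simp_all

/-- For `n ≥ 2` and `1 ≤ i < j ≤ n − 1`, the number of `ij`-normal
orthocell data `(w; t_1, …, t_d)` in `Sₙ` (over all ranks `d`) equals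
`D(n; i, j) = C(n,i)·C(n,j) − C(n,i−1)·C(n,j+1)`. -/
theorem card_ijNormal (n i j : ℕ) (hn : 2 ≤ n) (hi : 1 ≤ i) (hij : i < j) (hj : j ≤ n - 1) :
    (Nat.card {C : Σ d : ℕ, Equiv.Perm (Fin n) × (Fin d → Fin n × Fin n) //
        IJNormal i j C.2.1 C.2.2} : ℤ) =
      (n.choose i : ℤ) * n.choose j - (n.choose (i - 1) : ℤ) * n.choose (j + 1) := by
  have e : Nat.card {C : Σ d : ℕ, Equiv.Perm (Fin n) × (Fin d → Fin n × Fin n) //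
      IJNormal i j C.2.1 C.2.2} = Nat.card {f // Good n i j f} := by
    apply Nat.card_congr
    refine Equiv.ofBijective (fun C => ⟨(Fm i C.1.2.1, Gm i j C.1.1 C.1.2.1),
      good_datum hij ((ijNormal_iff i j hij _ _).1 C.2)⟩) ⟨?_, ?_⟩
    · rintro ⟨⟨d, w, t⟩, h⟩ ⟨⟨d', w', t'⟩, h'⟩ e
      simp only [Subtype.mk.injEq, Prod.mk.injEq] at e
      apply Subtype.ext
      exact datum_inj hij w w' t t' ((ijNormal_iff i j hij _ _).1 h)
        ((ijNormal_iff i j hij _ _).1 h') e.1 e.2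
    · rintro ⟨⟨f, g⟩, h⟩
      obtain ⟨d, w, t, h1, h2, h3⟩ := datum_surj hij f g h
      refine ⟨⟨⟨d, w, t⟩, (ijNormal_iff i j hij _ _).2 h1⟩, ?_⟩
      apply Subtype.ext
      exact Prod.ext h2 h3
  rw [e]
  have c := cnt_eq n i j (by omega)
  unfold cnt at c
  rw [c]
  unfold Ch
  rw [if_neg (by omega), if_neg (by omega), if_neg (by omega), if_neg (by omega)]
  have e1 : ((i : ℤ) - 1).toNat = i - 1 := by omega
  have e2 : ((j : ℤ) + 1).toNat = j + 1 := by omega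
  rw [e1, e2, Int.toNat_natCast, Int.toNat_natCast]

end QFlag
end
end
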